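/- Let f, r : ℝ → ℝ be of class C², let B > 0, and set R₁(B) = sup_{|s|≤B} |r'(s)| and F₁(B) = sup_{|s|≤B} |f'(s)|. Let y be a classical solution of y_t + (f(y))_x = y_xx + r(y) on [0,1] × (0,T) with homogeneous Dirichlet boundary conditions satisfying |y(x,t)| ≤ B for all x, t, and let η be a classical solution of the linearized equation η_t + (f'(y)η)_x = η_xx + r'(y)η on [0,1] × (0,T) with homogeneous Dirichlet boundary conditions and η(·,0) = v. Then for all 0 ≤ t < T, ‖η(·,t)²‖ ≤ ‖v²‖ e^{αt}, where α = 2R₁(B) + (3/2)F₁(B)² and ‖·‖ denotes the L²(0,1) norm (so ‖η²‖^{1/2} is the L⁴ norm of η). -/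

import Mathlib

open Set MeasureTheory intervalIntegral

/-- `y` is a classical solution of `y_t + (f(y))_x = y_xx + r(y)` on `[0,1] × (0,T)`
with homogeneous Dirichlet boundary conditions. -/
def IsClassicalSolutionOn (f r : ℝ → ℝ) (T : ℝ) (y : ℝ → ℝ → ℝ) : Prop :=
  ContinuousOn (fun pt : ℝ × ℝ => y pt.1 pt.2) (Icc 0 1 ×ˢ Ico 0 T) ∧
  (∀ t ∈ Ioo (0:ℝ) T, ContDiffOn ℝ 2 (fun x => y x t) (Icc 0 1)) ∧
  (∀ t ∈ Ico (0:ℝ) T, y 0 t = 0 ∧ y 1 t = 0) ∧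
  (∀ x ∈ Ioo (0:ℝ) 1, ∀ t ∈ Ioo (0:ℝ) T,
    HasDerivAt (fun s => y x s)
      (deriv (deriv (fun x' => y x' t)) x - deriv (fun x' => f (y x' t)) x + r (y x t)) t)

/-- `η` is a classical solution of the linearized equation
`η_t + (f'(y)η)_x = η_xx + r'(y)η` on `[0,1] × (0,T)` with homogeneous Dirichlet
boundary conditions. -/
def IsLinearizedSolutionOn (f r : ℝ → ℝ) (y : ℝ → ℝ → ℝ) (T : ℝ) (η : ℝ → ℝ → ℝ) : Prop :=
  ContinuousOn (fun pt : ℝ × ℝ => η pt.1 pt.2) (Icc 0 1 ×ˢ Ico 0 T) ∧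
  (∀ t ∈ Ioo (0:ℝ) T, ContDiffOn ℝ 2 (fun x => η x t) (Icc 0 1)) ∧
  (∀ t ∈ Ico (0:ℝ) T, η 0 t = 0 ∧ η 1 t = 0) ∧
  (∀ x ∈ Ioo (0:ℝ) 1, ∀ t ∈ Ioo (0:ℝ) T,
    HasDerivAt (fun s => η x s)
      (deriv (deriv (fun x' => η x' t)) x - deriv (fun x' => deriv f (y x' t) * η x' t) x
        + deriv r (y x t) * η x t) t)

open Filter Topology

theorem IsLocalMax.deriv_deriv_nonpos {h : ℝ → ℝ} {x : ℝ} (hh : IsLocalMax h x)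
    (hc : ContinuousAt h x) : deriv (deriv h) x ≤ 0 := by
  by_contra! hpos
  have hmin := isLocalMin_of_deriv_deriv_pos hpos hh.deriv_eq_zero hc
  have hconst : h =ᶠ[𝓝 x] fun _ => h x := by
    filter_upwards [hh, hmin] with z h1 h2 using le_antisymm h1 h2
  have h2 := hconst.deriv.deriv_eq
  simp only [deriv_const'] at h2
  linarith

/-- First and second order conditions at a point where `φ` touches `h` from above. -/
theorem IsLocalMax.deriv_conditions_of_sub {h φ : ℝ → ℝ} {x : ℝ}
    (hmax : IsLocalMax (fun z => h z - φ z) x)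
    (hh : ContDiffAt ℝ 2 h x) (hφ : ContDiffAt ℝ 2 φ x) :
    deriv h x = deriv φ x ∧ deriv (deriv h) x ≤ deriv (deriv φ) x := by
  have key : deriv (fun z => h z - φ z) =ᶠ[𝓝 x] fun z => deriv h z - deriv φ z := by
    filter_upwards [hh.eventually (by simp), hφ.eventually (by simp)] with z h1 h2
    exact deriv_fun_sub (h1.differentiableAt (by simp)) (h2.differentiableAt (by simp))
  have d1 : DifferentiableAt ℝ (deriv h) x :=
    (hh.derivWithin (m := 1) (by norm_num)).differentiableAt (by simp)
  have d2 : DifferentiableAt ℝ (deriv φ) x :=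
    (hφ.derivWithin (m := 1) (by norm_num)).differentiableAt (by simp)
  have h0 := hmax.deriv_eq_zero
  rw [key.eq_of_nhds] at h0
  have h2 := hmax.deriv_deriv_nonpos (hh.continuousAt.sub hφ.continuousAt)
  rw [key.deriv_eq, deriv_fun_sub d1 d2] at h2
  exact ⟨by linarith, by linarith⟩

theorem HasDerivWithinAt.nonneg_of_le_right {φ : ℝ → ℝ} {d a s : ℝ} (has : a < s)
    (hd : HasDerivWithinAt φ d (Icc a s) s) (hmax : ∀ τ ∈ Icc a s, φ τ ≤ φ s) : 0 ≤ d := by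
  rw [hasDerivWithinAt_iff_tendsto_slope, Icc_sdiff_right] at hd
  have : (𝓝[Ico a s] s).NeBot := by
    rw [← mem_closure_iff_nhdsWithin_neBot, closure_Ico has.ne]
    exact right_mem_Icc.2 has.le
  refine ge_of_tendsto hd ?_
  filter_upwards [self_mem_nhdsWithin] with τ hτ
  rw [slope_def_field]
  exact div_nonneg_of_nonpos (by linarith [hmax τ ⟨hτ.1, hτ.2.le⟩]) (by linarith [hτ.2])

theorem ContDiffOn.exists_continuousOn_hasDerivAt {g : ℝ → ℝ} {a b : ℝ} (hab : a < b)
    (hg : ContDiffOn ℝ 1 g (Icc a b)) :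
    ∃ g₁ : ℝ → ℝ, ContinuousOn g₁ (Icc a b) ∧ ∀ x ∈ Ioo a b, HasDerivAt g (g₁ x) x := by
  refine ⟨derivWithin g (Icc a b),
    hg.continuousOn_derivWithin (uniqueDiffOn_Icc hab) le_rfl, fun x hx => ?_⟩
  exact ((hg.differentiableOn (by simp)) x (Ioo_subset_Icc_self hx)).hasDerivWithinAt.hasDerivAt
    (Icc_mem_nhds hx.1 hx.2)

theorem ContDiffOn.exists_continuousOn_hasDerivAt_two {g : ℝ → ℝ} {a b : ℝ} (hab : a < b)
    (hg : ContDiffOn ℝ 2 g (Icc a b)) :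
    ∃ g₁ g₂ : ℝ → ℝ, ContinuousOn g₁ (Icc a b) ∧ ContinuousOn g₂ (Icc a b) ∧
      (∀ x ∈ Ioo a b, HasDerivAt g (g₁ x) x) ∧ (∀ x ∈ Ioo a b, HasDerivAt g₁ (g₂ x) x) ∧
      ∀ x ∈ Ioo a b, deriv (deriv g) x = g₂ x := by
  have hder : ContDiffOn ℝ 1 (derivWithin g (Icc a b)) (Icc a b) :=
    hg.derivWithin (uniqueDiffOn_Icc hab) (by norm_num)
  have h1 : ∀ x ∈ Ioo a b, HasDerivAt g (derivWithin g (Icc a b) x) x := fun x hx =>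
    ((hg.differentiableOn (by simp)) x (Ioo_subset_Icc_self hx)).hasDerivWithinAt.hasDerivAt
      (Icc_mem_nhds hx.1 hx.2)
  obtain ⟨g₂, hg₂, h2⟩ := hder.exists_continuousOn_hasDerivAt hab
  refine ⟨_, g₂, hder.continuousOn, hg₂, h1, h2, fun x hx => ?_⟩
  rw [← (h2 x hx).deriv]
  apply Filter.EventuallyEq.deriv_eq
  filter_upwards [Ioo_mem_nhds hx.1 hx.2] with z hz using (h1 z hz).deriv

theorem ContDiffOn.exists_bound_deriv {g : ℝ → ℝ} {a b : ℝ} (hab : a < b)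
    (hg : ContDiffOn ℝ 2 g (Icc a b)) :
    ∃ D : ℝ, 0 ≤ D ∧ (∀ x ∈ Ioo a b, |deriv g x| ≤ D ∧ |deriv (deriv g) x| ≤ D) ∧
      ∀ z ∈ Icc a b, ∀ x ∈ Icc z b, |g x - g z| ≤ D * (x - z) := by
  obtain ⟨g₁, g₂, c1, c2, h1, -, h2⟩ := hg.exists_continuousOn_hasDerivAt_two hab
  obtain ⟨C1, hC1⟩ := isCompact_Icc.exists_bound_of_continuousOn c1
  obtain ⟨C2, hC2⟩ := isCompact_Icc.exists_bound_of_continuousOn c2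
  have hD : ∀ x ∈ Ioo a b, |deriv g x| ≤ max 0 (max C1 C2) := fun x hx => by
    rw [(h1 x hx).deriv]
    exact (hC1 x (Ioo_subset_Icc_self hx)).trans (by simp)
  refine ⟨max 0 (max C1 C2), by simp, fun x hx => ⟨hD x hx, ?_⟩, fun z hz x hx => ?_⟩
  · rw [h2 x hx]
    exact (hC2 x (Ioo_subset_Icc_self hx)).trans (by simp)
  · rcases eq_or_lt_of_le hx.1 with rfl | hzx
    · simp
    · obtain ⟨c, hc, hc'⟩ := exists_deriv_eq_slope g hzx
        (hg.continuousOn.mono (Icc_subset_Icc hz.1 hx.2))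
        (fun w hw => (h1 w ⟨hz.1.trans_lt hw.1,
          hw.2.trans_le hx.2⟩).differentiableAt.differentiableWithinAt)
      have hpos : 0 < x - z := by linarith
      have := hD c ⟨hz.1.trans_lt hc.1, hc.2.trans_le hx.2⟩
      rw [hc', abs_div, abs_of_pos hpos, div_le_iff₀ hpos] at this
      exact this

/-- `u` vanishes at `x = 0, 1` and satisfies `u_t = u_xx - b u_x + g` pointwise for `t₀ < t ≤ t₁`,
with some coefficients bounded by `|b| ≤ F` and `|g| ≤ R`. -/
structure IsBoundedDriftSolution (F R t₀ t₁ : ℝ) (u : ℝ → ℝ → ℝ) : Prop where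
  continuousOn : ContinuousOn (fun p : ℝ × ℝ => u p.1 p.2) (Icc 0 1 ×ˢ Icc t₀ t₁)
  contDiffOn : ∀ t ∈ Icc t₀ t₁, ContDiffOn ℝ 2 (fun x => u x t) (Icc 0 1)
  boundary : ∀ t ∈ Icc t₀ t₁, u 0 t = 0 ∧ u 1 t = 0
  equation : ∀ x ∈ Ioo (0:ℝ) 1, ∀ t ∈ Ioc t₀ t₁, ∃ b g : ℝ, |b| ≤ F ∧ |g| ≤ R ∧
    HasDerivAt (fun s => u x s)
      (deriv (deriv (fun z => u z t)) x - b * deriv (fun z => u z t) x + g) t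

namespace IsBoundedDriftSolution

variable {F R t₀ t₁ : ℝ} {u : ℝ → ℝ → ℝ}

theorem neg (hu : IsBoundedDriftSolution F R t₀ t₁ u) :
    IsBoundedDriftSolution F R t₀ t₁ (fun x t => -u x t) where
  continuousOn := hu.continuousOn.neg
  contDiffOn t ht := (hu.contDiffOn t ht).neg
  boundary t ht := by simp [hu.boundary t ht]
  equation x hx t ht := by
    obtain ⟨b, g, hb, hg, hd⟩ := hu.equation x hx t ht
    refine ⟨b, -g, hb, by rwa [abs_neg], ?_⟩
    have h1 : deriv (fun z => -u z t) = fun z => -deriv (fun z => u z t) z := by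
      ext z; exact deriv.fun_neg
    rw [h1, deriv.fun_neg]
    refine hd.fun_neg.congr_deriv ?_
    ring

theorem contDiffAt (hu : IsBoundedDriftSolution F R t₀ t₁ u) {x t : ℝ} (hx : x ∈ Ioo (0:ℝ) 1)
    (ht : t ∈ Icc t₀ t₁) : ContDiffAt ℝ 2 (fun z => u z t) x :=
  (hu.contDiffOn t ht).contDiffAt (Icc_mem_nhds hx.1 hx.2)

/-- One-sided barrier in time issued from the initial slice. -/
theorem exists_le_add_mul (hu : IsBoundedDriftSolution F R t₀ t₁ u) (h01 : t₀ < t₁) :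
    ∃ C, ∀ x ∈ Icc (0:ℝ) 1, ∀ s ∈ Icc t₀ t₁, u x s ≤ u x t₀ + C * (s - t₀) := by
  have ht₀ : t₀ ∈ Icc t₀ t₁ := left_mem_Icc.2 h01.le
  obtain ⟨D, hD, hDx, -⟩ := (hu.contDiffOn t₀ ht₀).exists_bound_deriv zero_lt_one
  set C := D + |F| * D + |R| + 1
  have hCpos : 0 < C := by positivity
  refine ⟨C, ?_⟩
  have hc : ContinuousOn (fun p : ℝ × ℝ => u p.1 p.2 - u p.1 t₀ - C * (p.2 - t₀))
      (Icc 0 1 ×ˢ Icc t₀ t₁) := by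
    refine (hu.continuousOn.sub ?_).sub (by fun_prop)
    exact hu.continuousOn.comp (f := fun p : ℝ × ℝ => (p.1, t₀)) (by fun_prop)
      (fun p hp => ⟨hp.1, ht₀⟩)
  obtain ⟨⟨x, s⟩, ⟨hx, hs⟩, hmax⟩ := (isCompact_Icc.prod isCompact_Icc).exists_isMaxOn
    ⟨((0:ℝ), t₀), ⟨by simp, ht₀⟩⟩ hc
  suffices hle : u x s - u x t₀ - C * (s - t₀) ≤ 0 by
    intro x' hx' s' hs'
    have := hmax (show (x', s') ∈ Icc (0:ℝ) 1 ×ˢ Icc t₀ t₁ from ⟨hx', hs'⟩)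
    simp only [mem_ofPred_eq] at this
    linarith
  simp only at hx hs
  by_contra! hpos
  have hst : t₀ < s := by
    rcases eq_or_lt_of_le hs.1 with h | h
    · subst h; simp at hpos
    · exact h
  have hCs : 0 < C * (s - t₀) := mul_pos hCpos (by linarith)
  have hx0 : 0 < x := by
    rcases eq_or_lt_of_le hx.1 with h | h
    · subst h; rw [(hu.boundary s hs).1, (hu.boundary t₀ ht₀).1] at hpos; linarith
    · exact h
  have hx1 : x < 1 := by
    rcases eq_or_lt_of_le hx.2 with h | h
    · subst h; rw [(hu.boundary s hs).2, (hu.boundary t₀ ht₀).2] at hpos; linarith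
    · exact h
  have hxI : x ∈ Ioo (0:ℝ) 1 := ⟨hx0, hx1⟩
  obtain ⟨b, g, hb, hg, hd⟩ := hu.equation x hxI s ⟨hst, hs.2⟩
  have hspace : IsLocalMax (fun z => u z s - u z t₀) x := by
    filter_upwards [Icc_mem_nhds hx0 hx1] with z hz
    have := hmax (show (z, s) ∈ Icc (0:ℝ) 1 ×ˢ Icc t₀ t₁ from ⟨hz, hs⟩)
    simp only [mem_ofPred_eq] at this
    linarith
  obtain ⟨e1, e2⟩ := hspace.deriv_conditions_of_sub (hu.contDiffAt hxI hs) (hu.contDiffAt hxI ht₀)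
  have htime : HasDerivWithinAt (fun τ => u x τ - u x t₀ - C * (τ - t₀))
      (deriv (deriv (fun z => u z s)) x - b * deriv (fun z => u z s) x + g - C) (Icc t₀ s) s := by
    have := ((hd.sub_const (u x t₀)).fun_sub
      (((hasDerivAt_id s).sub_const t₀).const_mul C)).hasDerivWithinAt (s := Icc t₀ s)
    simpa using this
  have hnn := htime.nonneg_of_le_right hst fun τ hτ =>
    hmax (show (x, τ) ∈ Icc (0:ℝ) 1 ×ˢ Icc t₀ t₁ from ⟨hx, hτ.1, hτ.2.trans hs.2⟩)
  obtain ⟨b1, b2⟩ := hDx x hxI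
  rw [e1] at hnn
  have hbD : |b * deriv (fun z => u z t₀) x| ≤ |F| * D := by
    rw [abs_mul]
    exact mul_le_mul (hb.trans (le_abs_self F)) b1 (abs_nonneg _) (abs_nonneg _)
  linarith [neg_abs_le (b * deriv (fun z => u z t₀) x), le_abs_self g, le_abs_self R,
    le_abs_self (deriv (deriv (fun z => u z t₀)) x)]

theorem exists_abs_sub_le_mul (hu : IsBoundedDriftSolution F R t₀ t₁ u) (h01 : t₀ < t₁) :
    ∃ C, ∀ x ∈ Icc (0:ℝ) 1, ∀ s ∈ Icc t₀ t₁, |u x s - u x t₀| ≤ C * (s - t₀) := by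
  obtain ⟨C, hC⟩ := hu.exists_le_add_mul h01
  obtain ⟨C', hC'⟩ := hu.neg.exists_le_add_mul h01
  refine ⟨max C C', fun x hx s hs => ?_⟩
  have hs0 : 0 ≤ s - t₀ := by linarith [hs.1]
  have h1 := mul_le_mul_of_nonneg_right (le_max_left C C') hs0
  have h2 := mul_le_mul_of_nonneg_right (le_max_right C C') hs0
  rw [abs_le]
  constructor <;> linarith [hC x hx s hs, hC' x hx s hs]

/-- The concave modulus `σ ↦ N e^λ (1 - e^{-λ σ}) / λ`. -/
noncomputable def modulus (l N σ : ℝ) : ℝ := N * Real.exp l * (1 - Real.exp (-l * σ)) / l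

theorem hasDerivAt_modulus {l : ℝ} (hl : l ≠ 0) (N σ : ℝ) :
    HasDerivAt (modulus l N) (N * Real.exp l * Real.exp (-l * σ)) σ := by
  have h : HasDerivAt (fun σ : ℝ => Real.exp (-l * σ)) (Real.exp (-l * σ) * (-l)) σ := by
    simpa using ((hasDerivAt_id σ).const_mul (-l)).exp
  have := ((h.const_sub 1).const_mul (N * Real.exp l)).div_const l
  refine this.congr_deriv ?_
  field_simp

theorem contDiff_modulus (l N : ℝ) : ContDiff ℝ 2 (modulus l N) := by
  unfold modulus
  fun_prop

theorem deriv_modulus {l : ℝ} (hl : l ≠ 0) (N : ℝ) :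
    deriv (modulus l N) = fun σ => N * Real.exp l * Real.exp (-l * σ) :=
  funext fun σ => (hasDerivAt_modulus hl N σ).deriv

theorem deriv_deriv_modulus {l : ℝ} (hl : l ≠ 0) (N : ℝ) :
    deriv (deriv (modulus l N)) = fun σ => -l * (N * Real.exp l * Real.exp (-l * σ)) := by
  rw [deriv_modulus hl]
  ext σ
  have h : HasDerivAt (fun σ : ℝ => Real.exp (-l * σ)) (Real.exp (-l * σ) * (-l)) σ := by
    simpa using ((hasDerivAt_id σ).const_mul (-l)).exp
  rw [(h.const_mul (N * Real.exp l)).deriv]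
  ring

theorem mul_le_modulus {l N σ : ℝ} (hl : 0 < l) (hN : 0 ≤ N) (hσ : σ ∈ Icc (0:ℝ) 1) :
    N * σ ≤ modulus l N σ := by
  have h1 : l * σ * Real.exp (-l * σ) ≤ 1 - Real.exp (-l * σ) := by
    have h := mul_le_mul_of_nonneg_right (Real.add_one_le_exp (l * σ)) (Real.exp_pos (-l * σ)).le
    rw [← Real.exp_add, show l * σ + -l * σ = 0 by ring, Real.exp_zero] at h
    linarith
  have h2 : 1 ≤ Real.exp l * Real.exp (-l * σ) := by
    rw [← Real.exp_add]
    exact Real.one_le_exp (by nlinarith [hσ.2])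
  rw [modulus, le_div_iff₀ hl]
  calc N * σ * l = N * (l * σ) * 1 := by ring
    _ ≤ N * (l * σ) * (Real.exp l * Real.exp (-l * σ)) :=
        mul_le_mul_of_nonneg_left h2 (mul_nonneg hN (mul_nonneg hl.le hσ.1))
    _ = N * Real.exp l * (l * σ * Real.exp (-l * σ)) := by ring
    _ ≤ _ := mul_le_mul_of_nonneg_left h1 (by positivity)

theorem modulus_le_mul {l N : ℝ} (hl : 0 < l) (hN : 0 ≤ N) (σ : ℝ) :
    modulus l N σ ≤ N * Real.exp l * σ := by
  rw [modulus, div_le_iff₀ hl]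
  have := Real.add_one_le_exp (-l * σ)
  calc _ ≤ N * Real.exp l * (l * σ) := mul_le_mul_of_nonneg_left (by linarith) (by positivity)
    _ = _ := by ring

/-- Propagation of a one-sided modulus of continuity in space, by doubling the variables. -/
theorem sub_le_modulus (hu : IsBoundedDriftSolution F R t₀ t₁ u) (hF : 0 ≤ F) {N : ℝ}
    (hN : 0 ≤ N) (hRN : R < N) (h01 : t₀ ≤ t₁)
    (hinit : ∀ z ∈ Icc (0:ℝ) 1, ∀ x ∈ Icc z 1, u x t₀ - u z t₀ ≤ N * (x - z)) :
    ∀ s ∈ Icc t₀ t₁, ∀ z ∈ Icc (0:ℝ) 1, ∀ x ∈ Icc z 1,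
      u x s - u z s ≤ modulus (F + 1) N (x - z) := by
  have hl : 0 < F + 1 := by linarith
  set Φ := modulus (F + 1) N with hΦ
  have hΦc : ContDiff ℝ 2 Φ := contDiff_modulus _ _
  set S : Set (ℝ × ℝ × ℝ) :=
    (Icc 0 1 ×ˢ Icc 0 1 ×ˢ Icc t₀ t₁) ∩ {p | p.2.1 ≤ p.1}
  have hScomp : IsCompact S :=
    (isCompact_Icc.prod (isCompact_Icc.prod isCompact_Icc)).inter_right
      (isClosed_le (by fun_prop) (by fun_prop))
  have hc : ContinuousOn (fun p : ℝ × ℝ × ℝ => u p.1 p.2.2 - u p.2.1 p.2.2 - Φ (p.1 - p.2.1)) S := by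
    refine (ContinuousOn.sub ?_ ?_).sub ?_
    · exact hu.continuousOn.comp (f := fun p : ℝ × ℝ × ℝ => (p.1, p.2.2)) (by fun_prop)
        (fun p hp => ⟨hp.1.1, hp.1.2.2⟩)
    · exact hu.continuousOn.comp (f := fun p : ℝ × ℝ × ℝ => (p.2.1, p.2.2)) (by fun_prop)
        (fun p hp => ⟨hp.1.2.1, hp.1.2.2⟩)
    · exact (hΦc.continuous.comp (by fun_prop)).continuousOn
  obtain ⟨⟨x, z, s⟩, hmem, hmax⟩ := hScomp.exists_isMaxOn
    ⟨((0:ℝ), (0:ℝ), t₀), ⟨⟨by simp, by simp, left_mem_Icc.2 h01⟩, by simp⟩⟩ hc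
  replace hmax : ∀ x' z' s', x' ∈ Icc (0:ℝ) 1 → z' ∈ Icc (0:ℝ) 1 → s' ∈ Icc t₀ t₁ → z' ≤ x' →
      u x' s' - u z' s' - Φ (x' - z') ≤ u x s - u z s - Φ (x - z) := fun x' z' s' h1 h2 h3 h4 =>
    hmax (show (x', z', s') ∈ S from ⟨⟨h1, h2, h3⟩, h4⟩)
  suffices hle : u x s - u z s - Φ (x - z) ≤ 0 by
    intro s' hs' z' hz' x' hx'
    linarith [hmax x' z' s' ⟨hz'.1.trans hx'.1, hx'.2⟩ hz' hs' hx'.1]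
  obtain ⟨⟨hx, hz, hs⟩, hzx⟩ := hmem
  simp only [mem_ofPred_eq] at hx hz hs hzx
  by_contra! hpos
  have hzx' : z < x := by
    rcases eq_or_lt_of_le hzx with h | h
    · subst h; simp [hΦ, modulus] at hpos
    · exact h
  have hΦpos : 0 ≤ Φ (x - z) := le_trans (mul_nonneg hN (by linarith))
    (mul_le_modulus hl hN (σ := x - z) ⟨by linarith, by linarith [hx.2, hz.1]⟩)
  have hst : t₀ < s := by
    rcases eq_or_lt_of_le hs.1 with h | h
    · subst h
      linarith [hinit z hz x ⟨hzx, hx.2⟩,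
        mul_le_modulus hl hN (σ := x - z) ⟨by linarith, by linarith [hx.2, hz.1]⟩]
    · exact h
  set E := N * Real.exp (F + 1) * Real.exp (-(F + 1) * (x - z)) with hE
  have hNE : N ≤ E := by
    have : 1 ≤ Real.exp (F + 1) * Real.exp (-(F + 1) * (x - z)) := by
      rw [← Real.exp_add]
      exact Real.one_le_exp (by nlinarith [hx.2, hz.1])
    rw [hE, mul_assoc]
    exact le_mul_of_one_le_right hN this
  have hdrift : ∀ b g : ℝ, |b| ≤ F → |g| ≤ R → -(F + 1) * E - b * E + g < 0 := by
    intro b g hb hg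
    nlinarith [neg_abs_le b, le_abs_self g,
      mul_nonneg (hN.trans hNE) (by linarith [neg_abs_le b] : 0 ≤ F + b)]
  have hdx : ∃ d, HasDerivWithinAt (fun τ => u x τ) d (Icc t₀ s) s ∧ d ≤ 0 ∧ (x < 1 → d < 0) := by
    rcases eq_or_lt_of_le hx.2 with h | h
    · refine ⟨0, ?_, le_rfl, fun h' => absurd h h'.ne⟩
      refine (hasDerivWithinAt_const s (Icc t₀ s) (0:ℝ)).congr_of_mem (fun τ hτ => ?_)
        (right_mem_Icc.2 hst.le)
      rw [h]
      exact (hu.boundary τ ⟨hτ.1, hτ.2.trans hs.2⟩).2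
    · have hxI : x ∈ Ioo (0:ℝ) 1 := ⟨by linarith [hz.1], h⟩
      obtain ⟨b, g, hb, hg, hd⟩ := hu.equation x hxI s ⟨hst, hs.2⟩
      have hspace : IsLocalMax (fun w => u w s - Φ (w - z)) x := by
        filter_upwards [Icc_mem_nhds hzx' h] with w hw
        linarith [hmax w z s ⟨hz.1.trans hw.1, hw.2⟩ hz hs hw.1]
      obtain ⟨e1, e2⟩ := hspace.deriv_conditions_of_sub (hu.contDiffAt hxI hs)
        (hΦc.comp (contDiff_id.sub contDiff_const)).contDiffAt
      have e3 : deriv (fun w => Φ (w - z)) = fun w => deriv Φ (w - z) := by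
        ext w; exact deriv_comp_sub_const Φ z w
      rw [e3] at e1 e2
      rw [deriv_comp_sub_const (deriv Φ) z x, hΦ, deriv_deriv_modulus hl.ne'] at e2
      rw [hΦ, deriv_modulus hl.ne'] at e1
      have hneg : deriv (deriv (fun w => u w s)) x - b * deriv (fun w => u w s) x + g < 0 := by
        rw [e1]
        linarith [hdrift b g hb hg]
      exact ⟨_, hd.hasDerivWithinAt, hneg.le, fun _ => hneg⟩
  have hdz : ∃ d, HasDerivWithinAt (fun τ => u z τ) d (Icc t₀ s) s ∧ 0 ≤ d ∧ (0 < z → 0 < d) := by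
    rcases eq_or_lt_of_le hz.1 with h | h
    · refine ⟨0, ?_, le_rfl, fun h' => absurd h h'.ne⟩
      refine (hasDerivWithinAt_const s (Icc t₀ s) (0:ℝ)).congr_of_mem (fun τ hτ => ?_)
        (right_mem_Icc.2 hst.le)
      rw [← h]
      exact (hu.boundary τ ⟨hτ.1, hτ.2.trans hs.2⟩).1
    · have hzI : z ∈ Ioo (0:ℝ) 1 := ⟨h, by linarith [hx.2]⟩
      obtain ⟨b, g, hb, hg, hd⟩ := hu.neg.equation z hzI s ⟨hst, hs.2⟩
      have hspace : IsLocalMax (fun w => -u w s - Φ (x - w)) z := by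
        filter_upwards [Icc_mem_nhds h hzx'] with w hw
        linarith [hmax x w s hx ⟨hw.1, hw.2.trans hx.2⟩ hs hw.2]
      obtain ⟨e1, e2⟩ := hspace.deriv_conditions_of_sub (hu.neg.contDiffAt hzI hs)
        (hΦc.comp (contDiff_const.sub contDiff_id)).contDiffAt
      have e3 : deriv (fun w => Φ (x - w)) = fun w => -deriv Φ (x - w) := by
        ext w; exact deriv_comp_const_sub Φ x w
      rw [e3] at e1 e2
      rw [deriv.fun_neg, deriv_comp_const_sub (deriv Φ) x z, neg_neg, hΦ,
        deriv_deriv_modulus hl.ne'] at e2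
      rw [hΦ, deriv_modulus hl.ne'] at e1
      have hneg : deriv (deriv (fun w => -u w s)) z - b * deriv (fun w => -u w s) z + g < 0 := by
        rw [e1]
        have := hdrift (-b) g (by rwa [abs_neg]) hg
        linarith
      have hd' := hd.hasDerivWithinAt (s := Icc t₀ s) |>.fun_neg
      simp only [neg_neg] at hd'
      exact ⟨_, hd', by linarith, fun _ => by linarith⟩
  obtain ⟨dx, hdx, hdx0, hdx1⟩ := hdx
  obtain ⟨dz, hdz, hdz0, hdz1⟩ := hdz
  have hnn := ((hdx.fun_sub hdz).sub_const (Φ (x - z))).nonneg_of_le_right hst fun τ hτ =>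
    hmax x z τ hx hz ⟨hτ.1, hτ.2.trans hs.2⟩ hzx
  rcases eq_or_lt_of_le hx.2 with h1 | h1
  · rcases eq_or_lt_of_le hz.1 with h0 | h0
    · subst h1
      rw [← h0, (hu.boundary s hs).1, (hu.boundary s hs).2] at hpos
      rw [← h0] at hΦpos
      linarith
    · linarith [hdz1 h0]
  · linarith [hdx1 h1]

/-- Uniform gradient bound up to the initial time. -/
theorem exists_abs_deriv_le (hu : IsBoundedDriftSolution F R t₀ t₁ u) (hF : 0 ≤ F)
    (h01 : t₀ ≤ t₁) :
    ∃ K, ∀ s ∈ Icc t₀ t₁, ∀ x ∈ Ioo (0:ℝ) 1, |deriv (fun z => u z s) x| ≤ K := by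
  obtain ⟨D, hD, -, hDL⟩ :=
    (hu.contDiffOn t₀ (left_mem_Icc.2 h01)).exists_bound_deriv zero_lt_one
  set N := D + |R| + 1
  have hN : 0 ≤ N := by positivity
  have hRN : R < N := by linarith [le_abs_self R]
  have hDN : D ≤ N := by linarith [abs_nonneg R]
  have hl : 0 < F + 1 := by linarith
  have hinit : ∀ z ∈ Icc (0:ℝ) 1, ∀ x ∈ Icc z 1, |u x t₀ - u z t₀| ≤ N * (x - z) :=
    fun z hz x hx => (hDL z hz x hx).trans
      (mul_le_mul_of_nonneg_right hDN (by linarith [hx.1]))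
  have h1 := hu.sub_le_modulus hF hN hRN h01 fun z hz x hx =>
    (le_abs_self _).trans (hinit z hz x hx)
  have h2 := hu.neg.sub_le_modulus hF hN hRN h01 fun z hz x hx => by
    linarith [neg_abs_le (u x t₀ - u z t₀), hinit z hz x hx]
  have hlip : ∀ s ∈ Icc t₀ t₁, ∀ z ∈ Icc (0:ℝ) 1, ∀ x ∈ Icc z 1,
      |u x s - u z s| ≤ N * Real.exp (F + 1) * (x - z) := by
    intro s hs z hz x hx
    have := modulus_le_mul hl hN (x - z)
    rw [abs_le]
    constructor <;> linarith [h1 s hs z hz x hx, h2 s hs z hz x hx]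
  refine ⟨N * Real.exp (F + 1), fun s hs x hx => ?_⟩
  rw [← Real.norm_eq_abs]
  refine norm_deriv_le_of_lip' (by positivity) ?_
  filter_upwards [Icc_mem_nhds hx.1 hx.2] with w hw
  simp only [Real.norm_eq_abs]
  rcases le_total x w with h | h
  · rw [abs_of_nonneg (by linarith : 0 ≤ w - x)]
    exact hlip s hs x (Ioo_subset_Icc_self hx) w ⟨h, hw.2⟩
  · rw [abs_sub_comm, abs_sub_comm w x, abs_of_nonneg (by linarith : 0 ≤ x - w)]
    exact hlip s hs w hw x ⟨h, hx.2.le⟩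

end IsBoundedDriftSolution

theorem integral_four_mul_pow_three_mul_le {w b c : ℝ → ℝ} {F R : ℝ}
    (hw : ContDiffOn ℝ 2 w (Icc 0 1)) (hb : ContDiffOn ℝ 1 b (Icc 0 1))
    (hc : ContinuousOn c (Icc 0 1)) (hw0 : w 0 = 0) (hw1 : w 1 = 0)
    (hbF : ∀ x ∈ Icc (0:ℝ) 1, |b x| ≤ F) (hcR : ∀ x ∈ Icc (0:ℝ) 1, |c x| ≤ R) :
    ∫ x in (0:ℝ)..1, 4 * w x ^ 3 *
        (deriv (deriv w) x - deriv (fun z => b z * w z) x + c x * w x) ≤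
      (4 * R + 3 * F ^ 2) * ∫ x in (0:ℝ)..1, w x ^ 4 := by
  obtain ⟨w₁, w₂, hw₁, hw₂, hd, hd₁, hdd⟩ := hw.exists_continuousOn_hasDerivAt_two zero_lt_one
  obtain ⟨b₁, hb₁, hdb⟩ := hb.exists_continuousOn_hasDerivAt zero_lt_one
  have hwc := hw.continuousOn
  have hbc := hb.continuousOn
  set φ : ℝ → ℝ := fun x => 4 * w x ^ 3 * (w₂ x - (b₁ x * w x + b x * w₁ x) + c x * w x) with hφ
  have hφc : ContinuousOn φ (Icc 0 1) := by fun_prop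
  have hpow : ContinuousOn (fun x => (4 * R + 3 * F ^ 2) * w x ^ 4) (Icc 0 1) := by fun_prop
  have hcongr : ∫ x in (0:ℝ)..1, 4 * w x ^ 3 *
      (deriv (deriv w) x - deriv (fun z => b z * w z) x + c x * w x) = ∫ x in (0:ℝ)..1, φ x := by
    rw [integral_of_le zero_le_one, integral_of_le zero_le_one, integral_Ioc_eq_integral_Ioo,
      integral_Ioc_eq_integral_Ioo]
    refine setIntegral_congr_fun measurableSet_Ioo fun x hx => ?_
    simp only [hφ]
    rw [hdd x hx, ((hdb x hx).fun_mul (hd x hx)).deriv]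
  have hmain := integral_le_sub_of_hasDeriv_right_of_le
    (g := fun x => 4 * w x ^ 3 * (w₁ x - b x * w x))
    (g' := fun x => 12 * w x ^ 2 * w₁ x * (w₁ x - b x * w x)
      + 4 * w x ^ 3 * (w₂ x - (b₁ x * w x + b x * w₁ x)))
    (φ := fun x => φ x - (4 * R + 3 * F ^ 2) * w x ^ 4) zero_le_one (by fun_prop)
    (fun x hx => by
      refine HasDerivAt.hasDerivWithinAt ?_
      refine ((((hd x hx).fun_pow 3).const_mul 4).fun_mul
        ((hd₁ x hx).fun_sub ((hdb x hx).fun_mul (hd x hx)))).congr_deriv ?_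
      simp only [Nat.cast_ofNat, Nat.reduceSub]
      ring)
    ((hφc.sub hpow).integrableOn_Icc)
    (fun x hx => by
      have h1 := hcR x (Ioo_subset_Icc_self hx)
      have h2 : b x ^ 2 ≤ F ^ 2 := sq_le_sq'
        (by linarith [neg_abs_le (b x), hbF x (Ioo_subset_Icc_self hx)])
        ((le_abs_self _).trans (hbF x (Ioo_subset_Icc_self hx)))
      have h3 := mul_le_mul_of_nonneg_right ((le_abs_self _).trans h1) (by positivity : 0 ≤ w x ^ 4)
      have h4 := mul_le_mul_of_nonneg_right h2 (by positivity : 0 ≤ w x ^ 4)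
      have h5 := mul_nonneg (sq_nonneg (w x)) (sq_nonneg (2 * w₁ x - b x * w x))
      simp only [hφ]
      nlinarith)
  rw [intervalIntegral.integral_sub (hφc.intervalIntegrable_of_Icc zero_le_one)
    (hpow.intervalIntegrable_of_Icc zero_le_one), intervalIntegral.integral_const_mul, hw0,
    hw1] at hmain
  rw [hcongr]
  linarith

theorem abs_pow_four_sub_pow_four_le {a b M : ℝ} (ha : |a| ≤ M) (hb : |b| ≤ M) :
    |a ^ 4 - b ^ 4| ≤ 4 * M ^ 3 * |a - b| := by
  have hM : 0 ≤ M := (abs_nonneg a).trans ha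
  have h : a ^ 4 - b ^ 4 = (a ^ 3 + a ^ 2 * b + a * b ^ 2 + b ^ 3) * (a - b) := by ring
  rw [h, abs_mul]
  refine mul_le_mul_of_nonneg_right ?_ (abs_nonneg _)
  have h1 : |a ^ 3| ≤ M ^ 3 := by rw [abs_pow]; gcongr
  have h2 : |a ^ 2 * b| ≤ M ^ 2 * M := by rw [abs_mul, abs_pow]; gcongr
  have h3 : |a * b ^ 2| ≤ M * M ^ 2 := by rw [abs_mul, abs_pow]; gcongr
  have h4 : |b ^ 3| ≤ M ^ 3 := by rw [abs_pow]; gcongr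
  calc _ ≤ |a ^ 3| + |a ^ 2 * b| + |a * b ^ 2| + |b ^ 3| :=
        (abs_add_le _ _).trans (add_le_add_left ((abs_add_le _ _).trans
          (add_le_add_left (abs_add_le _ _) _)) _)
    _ ≤ _ := by linarith [pow_succ M 2]

/-- Right derivative of `∫ u ^ 4` under a forward-in-time Lipschitz bound. -/
theorem tendsto_slope_integral_pow_four {u : ℝ → ℝ → ℝ} {d : ℝ → ℝ} {t t₁ M C : ℝ} (ht : t < t₁)
    (hu : ∀ s ∈ Icc t t₁, ContinuousOn (fun x => u x s) (Icc 0 1))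
    (hM : ∀ x ∈ Icc (0:ℝ) 1, ∀ s ∈ Icc t t₁, |u x s| ≤ M)
    (hC : ∀ x ∈ Icc (0:ℝ) 1, ∀ s ∈ Icc t t₁, |u x s - u x t| ≤ C * (s - t))
    (hd : ∀ x ∈ Ioo (0:ℝ) 1, HasDerivAt (fun s => u x s) (d x) t) :
    Tendsto (fun s => (s - t)⁻¹ *
        ((∫ x in (0:ℝ)..1, u x s ^ 4) - ∫ x in (0:ℝ)..1, u x t ^ 4)) (𝓝[>] t)
      (𝓝 (∫ x in (0:ℝ)..1, 4 * u x t ^ 3 * d x)) := by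
  have htI : t ∈ Icc t t₁ := left_mem_Icc.2 ht.le
  have hsub : uIoc (0:ℝ) 1 ⊆ Icc 0 1 := by
    rw [uIoc_of_le zero_le_one]; exact Ioc_subset_Icc_self
  have hev : ∀ᶠ s in 𝓝[>] t, s ∈ Ioc t t₁ := Ioc_mem_nhdsGT ht
  have hpow : ∀ s ∈ Icc t t₁, ContinuousOn (fun x => u x s ^ 4) (Icc 0 1) :=
    fun s hs => (hu s hs).pow 4
  have key : Tendsto (fun s => ∫ x in (0:ℝ)..1, (s - t)⁻¹ * (u x s ^ 4 - u x t ^ 4)) (𝓝[>] t)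
      (𝓝 (∫ x in (0:ℝ)..1, 4 * u x t ^ 3 * d x)) := by
    refine intervalIntegral.tendsto_integral_filter_of_dominated_convergence
      (fun _ => 4 * M ^ 3 * C) ?_ ?_ intervalIntegrable_const ?_
    · filter_upwards [hev] with s hs
      have : ContinuousOn (fun x => (s - t)⁻¹ * (u x s ^ 4 - u x t ^ 4)) (Icc 0 1) :=
        ((hpow s (Ioc_subset_Icc_self hs)).sub (hpow t htI)).const_mul _
      exact (this.mono hsub).aestronglyMeasurable measurableSet_uIoc
    · filter_upwards [hev] with s hs
      refine ae_of_all _ fun x hx => ?_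
      have hs' := Ioc_subset_Icc_self hs
      have hpos : 0 < s - t := sub_pos.2 hs.1
      rw [norm_mul, norm_inv, Real.norm_eq_abs, Real.norm_eq_abs, abs_of_pos hpos,
        inv_mul_le_iff₀ hpos]
      have hM0 : 0 ≤ M := (abs_nonneg _).trans (hM x (hsub hx) t htI)
      calc _ ≤ 4 * M ^ 3 * |u x s - u x t| :=
            abs_pow_four_sub_pow_four_le (hM x (hsub hx) s hs') (hM x (hsub hx) t htI)
        _ ≤ 4 * M ^ 3 * (C * (s - t)) :=
            mul_le_mul_of_nonneg_left (hC x (hsub hx) s hs') (by positivity)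
        _ = _ := by ring
    · have hne : ∀ᵐ x : ℝ, x ≠ 1 := by simp [ae_iff]
      filter_upwards [hne] with x hx1 hx
      rw [uIoc_of_le zero_le_one] at hx
      have h := (hd x ⟨hx.1, lt_of_le_of_ne hx.2 hx1⟩).fun_pow 4
      have h' := (hasDerivAt_iff_tendsto_slope.1 h).mono_left
        (nhdsWithin_mono t (show Ioi t ⊆ {t}ᶜ from fun s hs => ne_of_gt hs))
      simp only [Nat.cast_ofNat, Nat.reduceSub] at h'
      exact h'.congr fun s => by rw [slope_def_field, div_eq_inv_mul]
  refine key.congr' ?_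
  filter_upwards [hev] with s hs
  rw [intervalIntegral.integral_const_mul, intervalIntegral.integral_sub
    ((hpow s (Ioc_subset_Icc_self hs)).intervalIntegrable_of_Icc zero_le_one)
    ((hpow t htI).intervalIntegrable_of_Icc zero_le_one)]

theorem continuousOn_integral_pow_four {u : ℝ → ℝ → ℝ} {a b : ℝ}
    (hu : ContinuousOn (fun p : ℝ × ℝ => u p.1 p.2) (Icc 0 1 ×ˢ Icc a b)) :
    ContinuousOn (fun t => ∫ x in (0:ℝ)..1, u x t ^ 4) (Icc a b) := by
  obtain ⟨M, hM⟩ := (isCompact_Icc.prod isCompact_Icc).exists_bound_of_continuousOn hu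
  have hsub : uIoc (0:ℝ) 1 ⊆ Icc 0 1 := by
    rw [uIoc_of_le zero_le_one]; exact Ioc_subset_Icc_self
  intro t ht
  refine intervalIntegral.continuousWithinAt_of_dominated_interval (bound := fun _ => M ^ 4)
    ?_ ?_ intervalIntegrable_const ?_
  · filter_upwards [self_mem_nhdsWithin] with s hs
    have : ContinuousOn (fun x => u x s) (Icc 0 1) :=
      hu.comp (f := fun x => (x, s)) (by fun_prop) fun x hx => ⟨hx, hs⟩
    exact ((this.pow 4).mono hsub).aestronglyMeasurable measurableSet_uIoc
  · filter_upwards [self_mem_nhdsWithin] with s hs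
    refine ae_of_all _ fun x hx => ?_
    rw [norm_pow]
    exact pow_le_pow_left₀ (norm_nonneg _) (hM (x, s) ⟨hsub hx, hs⟩) 4
  · refine ae_of_all _ fun x hx => ?_
    have : ContinuousOn (fun s => u x s) (Icc a b) :=
      hu.comp (f := fun s => (x, s)) (by fun_prop) fun s hs => ⟨hsub hx, hs⟩
    exact (this.pow 4) t ht

theorem le_mul_exp_of_tendsto_slope {E D : ℝ → ℝ} {K t : ℝ} (ht : 0 < t)
    (hE : ContinuousOn E (Icc 0 t))
    (hlim : ∀ s ∈ Ioo 0 t, Tendsto (fun z => (z - s)⁻¹ * (E z - E s)) (𝓝[>] s) (𝓝 (D s)))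
    (hD : ∀ s ∈ Ioo 0 t, D s ≤ K * E s) : E t ≤ E 0 * Real.exp (K * t) := by
  have hstep : ∀ a ∈ Ioo 0 t, E t ≤ E a * Real.exp (K * (t - a)) := by
    intro a ha
    have := le_gronwallBound_of_liminf_deriv_right_le (f := E) (f' := D) (δ := E a) (K := K)
      (ε := 0) (hE.mono (Icc_subset_Icc_left ha.1.le))
      (fun s hs r hr => ((hlim s ⟨ha.1.trans_le hs.1, hs.2⟩).eventually_lt_const hr).frequently)
      le_rfl (fun s hs => by simpa using hD s ⟨ha.1.trans_le hs.1, hs.2⟩) t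
      (right_mem_Icc.2 ha.2.le)
    rwa [gronwallBound_ε0] at this
  have hcont : ContinuousOn (fun a => E a * Real.exp (K * (t - a))) (Icc 0 t) := by fun_prop
  have h0 : Tendsto (fun a => E a * Real.exp (K * (t - a))) (𝓝[>] 0)
      (𝓝 (E 0 * Real.exp (K * (t - 0)))) := by
    have := (hcont 0 (left_mem_Icc.2 ht.le)).mono Ioo_subset_Icc_self
    rwa [ContinuousWithinAt, nhdsWithin_Ioo_eq_nhdsGT ht] at this
  rw [sub_zero] at h0
  refine ge_of_tendsto h0 ?_
  filter_upwards [Ioo_mem_nhdsGT ht] with a ha using hstep a ha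

theorem abs_le_sSup_image_abs {g : ℝ → ℝ} (hg : Continuous g) {B s : ℝ} (hs : |s| ≤ B) :
    |g s| ≤ sSup ((fun s => |g s|) '' Icc (-B) B) :=
  le_csSup (isCompact_Icc.image hg.abs).bddAbove (mem_image_of_mem _ (abs_le.1 hs))

theorem IsClassicalSolutionOn.isBoundedDriftSolution {f r : ℝ → ℝ} {T B t₀ t₁ : ℝ}
    {y : ℝ → ℝ → ℝ} (hf : ContDiff ℝ 2 f) (hr : ContDiff ℝ 2 r)
    (hy : IsClassicalSolutionOn f r T y)
    (hyB : ∀ x ∈ Icc (0:ℝ) 1, ∀ t ∈ Ico (0:ℝ) T, |y x t| ≤ B) (h0 : 0 < t₀) (h1 : t₁ < T) :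
    ∃ R, IsBoundedDriftSolution (sSup ((fun s => |deriv f s|) '' Icc (-B) B)) R t₀ t₁ y := by
  obtain ⟨hc, hx, hbd, heq⟩ := hy
  refine ⟨sSup ((fun s => |r s|) '' Icc (-B) B), ?_, ?_, ?_, ?_⟩
  · exact hc.mono (prod_mono le_rfl fun t ht => ⟨h0.le.trans ht.1, ht.2.trans_lt h1⟩)
  · exact fun t ht => hx t ⟨h0.trans_le ht.1, ht.2.trans_lt h1⟩
  · exact fun t ht => hbd t ⟨h0.le.trans ht.1, ht.2.trans_lt h1⟩
  · intro x hxI t ht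
    have htT : t ∈ Ioo 0 T := ⟨h0.trans ht.1, ht.2.trans_lt h1⟩
    have hB := hyB x (Ioo_subset_Icc_self hxI) t (Ioo_subset_Ico_self htT)
    refine ⟨deriv f (y x t), r (y x t), abs_le_sSup_image_abs (hf.continuous_deriv (by simp)) hB,
      abs_le_sSup_image_abs hr.continuous hB, ?_⟩
    have hdy : DifferentiableAt ℝ (fun z => y z t) x :=
      (((hx t htT).contDiffAt (Icc_mem_nhds hxI.1 hxI.2)).differentiableAt (by simp))
    have hdf : DifferentiableAt ℝ f (y x t) := (hf.differentiable (by simp)) _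
    have hcomp : HasDerivAt (fun z => f (y z t)) (deriv f (y x t) * deriv (fun z => y z t) x) x :=
      hdf.hasDerivAt.comp x hdy.hasDerivAt
    simpa only [hcomp.deriv] using heq x hxI t htT

theorem IsLinearizedSolutionOn.isBoundedDriftSolution {f r : ℝ → ℝ} {T B t₀ t₁ : ℝ}
    {y η : ℝ → ℝ → ℝ} (hf : ContDiff ℝ 2 f) (hr : ContDiff ℝ 2 r) (hB : 0 ≤ B)
    (hy : IsClassicalSolutionOn f r T y)
    (hyB : ∀ x ∈ Icc (0:ℝ) 1, ∀ t ∈ Ico (0:ℝ) T, |y x t| ≤ B)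
    (hη : IsLinearizedSolutionOn f r y T η) (h0 : 0 < t₀) (h01 : t₀ ≤ t₁) (h1 : t₁ < T) :
    ∃ R, IsBoundedDriftSolution (sSup ((fun s => |deriv f s|) '' Icc (-B) B)) R t₀ t₁ η := by
  obtain ⟨R₀, hyR⟩ := hy.isBoundedDriftSolution hf hr hyB h0 h1
  have hf' : ContDiff ℝ 1 (deriv f) := hf.deriv'
  have hF : 0 ≤ sSup ((fun s => |deriv f s|) '' Icc (-B) B) :=
    (abs_nonneg _).trans (abs_le_sSup_image_abs (s := 0) hf'.continuous (by simpa using hB))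
  obtain ⟨K, hK⟩ := hyR.exists_abs_deriv_le hF h01
  obtain ⟨hc, hx, hbd, heq⟩ := hη
  have hc' : ContinuousOn (fun p : ℝ × ℝ => η p.1 p.2) (Icc 0 1 ×ˢ Icc t₀ t₁) :=
    hc.mono (prod_mono le_rfl fun t ht => ⟨h0.le.trans ht.1, ht.2.trans_lt h1⟩)
  obtain ⟨M, hM⟩ := (isCompact_Icc.prod isCompact_Icc).exists_bound_of_continuousOn hc'
  set F₂ := sSup ((fun s => |deriv (deriv f) s|) '' Icc (-B) B)
  set R₁ := sSup ((fun s => |deriv r s|) '' Icc (-B) B)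
  refine ⟨(R₁ + F₂ * K) * M, hc', ?_, ?_, ?_⟩
  · exact fun t ht => hx t ⟨h0.trans_le ht.1, ht.2.trans_lt h1⟩
  · exact fun t ht => hbd t ⟨h0.le.trans ht.1, ht.2.trans_lt h1⟩
  · intro x hxI t ht
    have htT : t ∈ Ioo 0 T := ⟨h0.trans ht.1, ht.2.trans_lt h1⟩
    have hxc := Ioo_subset_Icc_self hxI
    have htc := Ioc_subset_Icc_self ht
    have hyx := hyB x hxc t (Ioo_subset_Ico_self htT)
    have hF₂ := abs_le_sSup_image_abs (hf'.continuous_deriv (by simp)) hyx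
    have hR₁ := abs_le_sSup_image_abs (hr.continuous_deriv (by simp)) hyx
    refine ⟨deriv f (y x t),
      (deriv r (y x t) - deriv (deriv f) (y x t) * deriv (fun z => y z t) x) * η x t,
      abs_le_sSup_image_abs hf'.continuous hyx, ?_, ?_⟩
    · have h2 : |deriv (deriv f) (y x t) * deriv (fun z => y z t) x| ≤ F₂ * K := by
        rw [abs_mul]
        exact mul_le_mul hF₂ (hK t htc x hxI) (abs_nonneg _) ((abs_nonneg _).trans hF₂)
      have h3 := (abs_sub _ _).trans (add_le_add hR₁ h2)
      rw [abs_mul]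
      exact mul_le_mul h3 (hM (x, t) ⟨hxc, htc⟩) (abs_nonneg _) ((abs_nonneg _).trans h3)
    · have hdy : DifferentiableAt ℝ (fun z => y z t) x :=
        (hyR.contDiffAt hxI htc).differentiableAt (by simp)
      have hdη : DifferentiableAt ℝ (fun z => η z t) x :=
        ((hx t htT).contDiffAt (Icc_mem_nhds hxI.1 hxI.2)).differentiableAt (by simp)
      have hdf : DifferentiableAt ℝ (deriv f) (y x t) := (hf'.differentiable (by simp)) _
      have hcomp : HasDerivAt (fun z => deriv f (y z t))
          (deriv (deriv f) (y x t) * deriv (fun z => y z t) x) x :=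
        HasDerivAt.comp (h := fun z => y z t) (h₂ := deriv f) x hdf.hasDerivAt hdy.hasDerivAt
      refine (heq x hxI t htT).congr_deriv ?_
      rw [(hcomp.fun_mul hdη.hasDerivAt).deriv]
      ring

theorem integral_pow_four_le_mul_exp {f r : ℝ → ℝ} {T B t : ℝ}
    {y η : ℝ → ℝ → ℝ} (hf : ContDiff ℝ 2 f) (hr : ContDiff ℝ 2 r) (hB : 0 ≤ B)
    (hy : IsClassicalSolutionOn f r T y)
    (hyB : ∀ x ∈ Icc (0:ℝ) 1, ∀ t ∈ Ico (0:ℝ) T, |y x t| ≤ B)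
    (hη : IsLinearizedSolutionOn f r y T η) (ht : t ∈ Ioo 0 T) :
    ∫ x in (0:ℝ)..1, η x t ^ 4 ≤ (∫ x in (0:ℝ)..1, η x 0 ^ 4) *
      Real.exp ((4 * sSup ((fun s => |deriv r s|) '' Icc (-B) B)
        + 3 * sSup ((fun s => |deriv f s|) '' Icc (-B) B) ^ 2) * t) := by
  have hyx := hy.2.1
  obtain ⟨hηc, hηx, hηbd, hηeq⟩ := hη
  refine le_mul_exp_of_tendsto_slope (E := fun t => ∫ x in (0:ℝ)..1, η x t ^ 4)
    (D := fun t => ∫ x in (0:ℝ)..1, 4 * η x t ^ 3 * (deriv (deriv (fun x' => η x' t)) x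
      - deriv (fun x' => deriv f (y x' t) * η x' t) x + deriv r (y x t) * η x t)) ht.1
    (continuousOn_integral_pow_four (hηc.mono
      (prod_mono le_rfl fun s hs => ⟨hs.1, hs.2.trans_lt ht.2⟩))) ?_ ?_
  · intro s hs
    have hsT : s < T := hs.2.trans ht.2
    obtain ⟨t₁, hst, htT⟩ := exists_between hsT
    obtain ⟨R, hR⟩ := IsLinearizedSolutionOn.isBoundedDriftSolution hf hr hB
      hy hyB ⟨hηc, hηx, hηbd, hηeq⟩ hs.1 hst.le htT
    obtain ⟨C, hC⟩ := hR.exists_abs_sub_le_mul hst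
    obtain ⟨M, hM⟩ := (isCompact_Icc.prod isCompact_Icc).exists_bound_of_continuousOn
      hR.continuousOn
    exact tendsto_slope_integral_pow_four hst (fun τ hτ => (hR.contDiffOn τ hτ).continuousOn)
      (fun x hx τ hτ => hM (x, τ) ⟨hx, hτ⟩) hC (fun x hx => hηeq x hx s ⟨hs.1, hsT⟩)
  · intro s hs
    have hsT : s ∈ Ioo 0 T := ⟨hs.1, hs.2.trans ht.2⟩
    have hsT' := Ioo_subset_Ico_self hsT
    have hf' : ContDiff ℝ 1 (deriv f) := hf.deriv'
    have hr' : Continuous (deriv r) := hr.continuous_deriv (by simp)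
    exact integral_four_mul_pow_three_mul_le (w := fun x => η x s)
      (b := fun x => deriv f (y x s)) (c := fun x => deriv r (y x s)) (hηx s hsT)
      (hf'.comp_contDiffOn ((hyx s hsT).of_le (by norm_num)))
      (hr'.comp_continuousOn (hyx s hsT).continuousOn) (hηbd s hsT').1 (hηbd s hsT').2
      (fun x hx => abs_le_sSup_image_abs hf'.continuous (hyB x hx s hsT'))
      (fun x hx => abs_le_sSup_image_abs hr' (hyB x hx s hsT'))

/-- exponential `L⁴` bound `‖η(·,t)²‖ ≤ ‖v²‖ e^{αt}` with
`α = 2 R₁(B) + (3/2) F₁(B)²`.  Here `‖g²‖ = (∫₀¹ g⁴)^{1/2}` is the square of the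
`L⁴(0,1)` norm of `g`. -/
theorem eta_L4_bound
    (f r : ℝ → ℝ) (hf : ContDiff ℝ 2 f) (hr : ContDiff ℝ 2 r)
    (B : ℝ) (hB : 0 < B)
    (T : ℝ) (y η : ℝ → ℝ → ℝ) (v : ℝ → ℝ)
    (hy : IsClassicalSolutionOn f r T y)
    (hyB : ∀ x ∈ Icc (0:ℝ) 1, ∀ t ∈ Ico (0:ℝ) T, |y x t| ≤ B)
    (hη : IsLinearizedSolutionOn f r y T η)
    (hη0 : ∀ x ∈ Icc (0:ℝ) 1, η x 0 = v x) :
    ∀ t ∈ Ico (0:ℝ) T,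
      Real.sqrt (∫ x in (0:ℝ)..1, (η x t) ^ 4) ≤
        Real.sqrt (∫ x in (0:ℝ)..1, (v x) ^ 4) *
          Real.exp ((2 * sSup ((fun s => |deriv r s|) '' Icc (-B) B)
            + (3/2) * (sSup ((fun s => |deriv f s|) '' Icc (-B) B)) ^ 2) * t) := by
  intro t ht
  have h0 : ∫ x in (0:ℝ)..1, v x ^ 4 = ∫ x in (0:ℝ)..1, η x 0 ^ 4 :=
    integral_congr fun x hx => by
      rw [uIcc_of_le zero_le_one] at hx
      simp only [hη0 x hx]
  rw [h0]
  rcases eq_or_lt_of_le ht.1 with rfl | hpos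
  · simp
  · refine (Real.sqrt_le_sqrt (integral_pow_four_le_mul_exp hf hr hB.le hy hyB hη
      ⟨hpos, ht.2⟩)).trans_eq ?_
    rw [Real.sqrt_mul (integral_nonneg zero_le_one fun x _ => by positivity), ← Real.exp_half]
    congr 2
    ring
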